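/- Let ℓ ≥ 1 and t ≥ 1 be integers and let ν_1, …, ν_t ∈ (ℚ^{ℓ+1})^0_+, with ν_i = (x^{[i]}_1, …, x^{[i]}_{ℓ+1}). If j ≠ h are two distinct indices in {1,…,t} such that Σ_{i ≠ j} x^{[i]}_{ℓ+1} > −x^{[j]}_ℓ and Σ_{i ≠ h} x^{[i]}_1 < −x^{[h]}_2, then one obtains a contradiction; that is, the two conditions cannot hold simultaneously for distinct indices. -/

import Mathlib

/-- The largest entry of an antitone tuple with sum zero is nonnegative. -/
theorem first_nonneg_of_sum_eq_zero {n : ℕ} {x : Fin (n + 1) → ℚ} (hx : Antitone x)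
    (hsum : ∑ i, x i = 0) : 0 ≤ x 0 := by
  by_contra! hneg
  have hlt : ∑ i, x i < 0 :=
    Finset.sum_neg (fun i _ => (hx (Fin.zero_le i)).trans_lt hneg) Finset.univ_nonempty
  exact hlt.ne hsum

/-- The smallest entry of an antitone tuple with sum zero is nonpositive. -/
theorem last_nonpos_of_sum_eq_zero {n : ℕ} {x : Fin (n + 1) → ℚ} (hx : Antitone x)
    (hsum : ∑ i, x i = 0) : x (Fin.last n) ≤ 0 := by
  by_contra! hpos
  have hlt : 0 < ∑ i, x i :=
    Finset.sum_pos (fun i _ => hpos.trans_le (hx (Fin.le_last i))) Finset.univ_nonempty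
  exact hlt.ne' hsum

/-- For `ν₁, …, ν_t ∈ (ℚ^{ℓ+1})^0_+` and distinct indices `j ≠ h`, the
conditions `∑_{i ≠ j} x^{[i]}_{ℓ+1} > -x^{[j]}_ℓ` and `∑_{i ≠ h} x^{[i]}_1 < -x^{[h]}_2`
cannot hold simultaneously. -/
theorem stmt7 (ℓ t : ℕ) (hl : 1 ≤ ℓ) (ht : 1 ≤ t)
    (ν : Fin t → Fin (ℓ + 1) → ℚ)
    (hmono : ∀ p : Fin t, ∀ i j : Fin (ℓ + 1), i ≤ j → ν p j ≤ ν p i)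
    (hsum : ∀ p : Fin t, ∑ i, ν p i = 0)
    (j h : Fin t) (hjh : j ≠ h)
    (hj : (∑ i ∈ Finset.univ.filter (· ≠ j), ν i (Fin.last ℓ)) > -(ν j ⟨ℓ - 1, by omega⟩))
    (hh : (∑ i ∈ Finset.univ.filter (· ≠ h), ν i 0) < -(ν h ⟨1, by omega⟩)) :
    False := by
  have hanti : ∀ p, Antitone (ν p) := fun p a b hab => hmono p a b hab
  have hfirst : ν j 0 ≤ ∑ i ∈ Finset.univ.filter (· ≠ h), ν i 0 :=
    Finset.single_le_sum (f := fun i => ν i 0)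
      (fun i _ => first_nonneg_of_sum_eq_zero (hanti i) (hsum i)) (by simpa using hjh)
  have hlast : -ν h (Fin.last ℓ) ≤ ∑ i ∈ Finset.univ.filter (· ≠ j), -ν i (Fin.last ℓ) :=
    Finset.single_le_sum (f := fun i => -ν i (Fin.last ℓ))
      (fun i _ => neg_nonneg.mpr (last_nonpos_of_sum_eq_zero (hanti i) (hsum i)))
      (by simpa using hjh.symm)
  rw [Finset.sum_neg_distrib] at hlast
  have hj_le : ν j ⟨ℓ - 1, by omega⟩ ≤ ν j 0 := hanti j (Fin.zero_le _)
  have hh_ge : ν h (Fin.last ℓ) ≤ ν h ⟨1, by omega⟩ := hanti h (Fin.le_last _)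
  linarith
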